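/- Let ν = N(0, σ²Id) on R^d and let π be a probability measure supported in the Euclidean ball B(0,R). For λ ∈ (0,1), let p be the density of √λ·X + √(1−λ)·Z with X ~ π and Z ~ ν independent. Then, in the sense of quadratic forms, −(1/(σ²(1−λ)))·Id ≤ ∇² ln p(x) ≤ −((σ²(1−λ) − λR²)/(σ⁴(1−λ)²))·Id for all x ∈ R^d. -/

import Mathlib

open MeasureTheory

/-- Continuous functions are integrable for a finite measure carried by a ball. -/
theorem aux_integrable {d : ℕ} {V : Type*} [NormedAddCommGroup V]
    (π : Measure (EuclideanSpace ℝ (Fin d))) [IsProbabilityMeasure π] (R : ℝ)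
    (hb : ∀ᵐ y ∂π, y ∈ Metric.closedBall (0 : EuclideanSpace ℝ (Fin d)) R)
    (G : EuclideanSpace ℝ (Fin d) → V) (hG : Continuous G) : Integrable G π := by
  obtain ⟨B, hB⟩ := (isCompact_closedBall (0 : EuclideanSpace ℝ (Fin d)) R).exists_bound_of_continuousOn
    hG.continuousOn
  exact Integrable.of_bound hG.aestronglyMeasurable B (hb.mono fun y hy => hB y hy)

theorem aux_cont {d : ℕ} {V : Type*} [NormedAddCommGroup V] [NormedSpace ℝ V] (c : ℝ)
    (G : EuclideanSpace ℝ (Fin d) → V) (hG : Continuous G) :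
    Continuous (fun y : EuclideanSpace ℝ (Fin d) => (c • innerSL ℝ y).smulRight (G y)) := by
  have h : Continuous (fun y : EuclideanSpace ℝ (Fin d) =>
      ContinuousLinearMap.smulRightL ℝ (EuclideanSpace ℝ (Fin d)) V (c • innerSL ℝ y) (G y)) := by
    fun_prop
  exact h

/-- Differentiation of an exponential integral under the integral sign. -/
theorem aux_deriv {d : ℕ} {V : Type*} [NormedAddCommGroup V] [NormedSpace ℝ V]
    (π : Measure (EuclideanSpace ℝ (Fin d))) [IsProbabilityMeasure π] (R : ℝ)
    (hb : ∀ᵐ y ∂π, y ∈ Metric.closedBall (0 : EuclideanSpace ℝ (Fin d)) R) (c : ℝ)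
    (G : EuclideanSpace ℝ (Fin d) → V) (hG : Continuous G) (x : EuclideanSpace ℝ (Fin d)) :
    HasFDerivAt (fun x => ∫ y, Real.exp (c * inner ℝ y x) • G y ∂π)
      (∫ y, Real.exp (c * inner ℝ y x) • ((c • innerSL ℝ y).smulRight (G y)) ∂π) x := by
  have hcont : Continuous (fun q : EuclideanSpace ℝ (Fin d) × EuclideanSpace ℝ (Fin d) =>
      Real.exp (c * inner ℝ q.2 q.1) • ((c • innerSL ℝ q.2).smulRight (G q.2))) := by
    have h1 : Continuous (fun q : EuclideanSpace ℝ (Fin d) × EuclideanSpace ℝ (Fin d) =>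
      ((c • innerSL ℝ q.2).smulRight (G q.2))) := (aux_cont c G hG).comp continuous_snd
    have h2 : Continuous (fun q : EuclideanSpace ℝ (Fin d) × EuclideanSpace ℝ (Fin d) =>
      Real.exp (c * inner ℝ q.2 q.1)) := by fun_prop
    exact h2.smul h1
  obtain ⟨B, hB⟩ := ((isCompact_closedBall x 1).prod
    (isCompact_closedBall (0 : EuclideanSpace ℝ (Fin d)) R)).exists_bound_of_continuousOn
    hcont.continuousOn
  refine hasFDerivAt_integral_of_dominated_of_fderiv_le (bound := fun _ => B)
    (F' := fun x y => Real.exp (c * inner ℝ y x) • ((c • innerSL ℝ y).smulRight (G y)))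
    (Metric.closedBall_mem_nhds x one_pos) ?_ ?_ ?_ ?_ ?_ ?_
  · refine Filter.Eventually.of_forall fun z => Continuous.aestronglyMeasurable ?_
    fun_prop
  · exact aux_integrable π R hb _ (by fun_prop)
  · exact (hcont.comp (Continuous.prodMk_right x)).aestronglyMeasurable
  · filter_upwards [hb] with y hy z hz
    exact hB (z, y) ⟨hz, hy⟩
  · exact integrable_const B
  · refine Filter.Eventually.of_forall fun y z _ => ?_
    have h1 : HasFDerivAt (fun z : EuclideanSpace ℝ (Fin d) => c * inner ℝ y z)
        (c • innerSL ℝ y) z := ((innerSL ℝ y).hasFDerivAt (x := z)).const_mul c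
    have h2 := (h1.exp).smul_const (G y)
    convert h2 using 1
    ext v
    simp [smul_smul, mul_assoc]

theorem gaussian_compact_hessian_bounds {d : ℕ}
    (π : Measure (EuclideanSpace ℝ (Fin d))) [IsProbabilityMeasure π]
    (R σ : ℝ) (hR : 0 ≤ R) (hσ : 0 < σ)
    (hsupp : π (Metric.closedBall (0 : EuclideanSpace ℝ (Fin d)) R)ᶜ = 0)
    (l : ℝ) (hl0 : 0 < l) (hl1 : l < 1)
    (p : EuclideanSpace ℝ (Fin d) → ℝ)
    (hp : ∀ x, p x = ∫ y,
      (2 * Real.pi * (σ ^ 2 * (1 - l))) ^ (-(d : ℝ) / 2) *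
        Real.exp (-‖x - Real.sqrt l • y‖ ^ 2 / (2 * (σ ^ 2 * (1 - l)))) ∂π) :
    ∀ (x ξ : EuclideanSpace ℝ (Fin d)),
      -(1 / (σ ^ 2 * (1 - l))) * ‖ξ‖ ^ 2
        ≤ iteratedFDeriv ℝ 2 (fun y => Real.log (p y)) x ![ξ, ξ] ∧
      iteratedFDeriv ℝ 2 (fun y => Real.log (p y)) x ![ξ, ξ]
        ≤ -((σ ^ 2 * (1 - l) - l * R ^ 2) / (σ ^ 4 * (1 - l) ^ 2)) * ‖ξ‖ ^ 2 := by
  intro x ξ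
  have hb : ∀ᵐ y ∂π, y ∈ Metric.closedBall (0 : EuclideanSpace ℝ (Fin d)) R := by
    rw [ae_iff]; exact hsupp
  have e4 : σ ^ 4 * (1 - l) ^ 2 = (σ ^ 2 * (1 - l)) ^ 2 := by ring
  rw [e4]
  have hs : 0 < σ ^ 2 * (1 - l) := by have := sub_pos.2 hl1; positivity
  generalize σ ^ 2 * (1 - l) = s at *
  set C : ℝ := (2 * Real.pi * s) ^ (-(d : ℝ) / 2) with hC
  have hCpos : 0 < C := by positivity
  set c : ℝ := Real.sqrt l / s with hc
  have hc2 : c ^ 2 = l / s ^ 2 := by rw [hc, div_pow, Real.sq_sqrt hl0.le]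
  let G0 : EuclideanSpace ℝ (Fin d) → ℝ := fun y => C * Real.exp (-(l * ‖y‖ ^ 2) / (2 * s))
  have hG0 : Continuous G0 := by fun_prop
  have hG0pos : ∀ y, 0 < G0 y := fun y => by positivity
  let G1 := fun y : EuclideanSpace ℝ (Fin d) => (c • innerSL ℝ y).smulRight (G0 y)
  have hG1 : Continuous G1 := by fun_prop
  let H0 := fun x : EuclideanSpace ℝ (Fin d) => ∫ y, Real.exp (c * inner ℝ y x) • G0 y ∂π
  let H1 := fun x : EuclideanSpace ℝ (Fin d) => ∫ y, Real.exp (c * inner ℝ y x) • G1 y ∂π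
  let H2 := fun x : EuclideanSpace ℝ (Fin d) =>
    ∫ y, Real.exp (c * inner ℝ y x) • ((c • innerSL ℝ y).smulRight (G1 y)) ∂π
  have hH0 : ∀ x, HasFDerivAt H0 (H1 x) x := fun x => aux_deriv π R hb c G0 hG0 x
  have hH1 : ∀ x, HasFDerivAt H1 (H2 x) x := fun x => aux_deriv π R hb c G1 hG1 x
  have hH0pos : ∀ x, 0 < H0 x := fun x => by
    refine (integral_pos_iff_support_of_nonneg (fun y => ?_) ?_).2 ?_
    · have := hG0pos y
      simp only [smul_eq_mul, Pi.zero_apply]; positivity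
    · exact aux_integrable π R hb _ (by fun_prop)
    · have : Function.support (fun y => Real.exp (c * inner ℝ y x) • G0 y) = Set.univ := by
        ext y
        simp [(hG0pos y).ne']
      rw [this]; simp
  have hpH : ∀ x, p x = Real.exp (-(1 / (2 * s)) * ‖x‖ ^ 2) * H0 x := fun x => by
    rw [hp, ← integral_const_mul]
    congr 1; ext y
    simp only [G0, smul_eq_mul]
    have : -‖x - Real.sqrt l • y‖ ^ 2 / (2 * s) = -(1 / (2 * s)) * ‖x‖ ^ 2 +
        (c * inner ℝ y x + -(l * ‖y‖ ^ 2) / (2 * s)) := by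
      rw [norm_sub_sq_real, norm_smul, mul_pow, inner_smul_right, real_inner_comm, hc,
        Real.norm_eq_abs, sq_abs, Real.sq_sqrt hl0.le]
      field_simp
      ring
    rw [this, Real.exp_add, Real.exp_add]; ring
  have hlog : (fun y => Real.log (p y)) =
      fun x => -(1 / (2 * s)) * ‖x‖ ^ 2 + Real.log (H0 x) := by
    ext z
    rw [hpH, Real.log_mul (Real.exp_ne_zero _) (hH0pos z).ne', Real.log_exp]
  have hf1 : fderiv ℝ (fun y => Real.log (p y)) =
      fun x => (-(1 / s)) • innerSL ℝ x + (H0 x)⁻¹ • H1 x := by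
    ext1 z
    rw [hlog]
    have h1 := ((hasStrictFDerivAt_norm_sq z).hasFDerivAt.const_mul (-(1 / (2 * s)))).add
      ((hH0 z).log (hH0pos z).ne')
    refine h1.fderiv.trans ?_
    congr 1
    ext v
    simp
    field_simp
  have hf2 := ((((innerSL ℝ (E := EuclideanSpace ℝ (Fin d))).hasFDerivAt (x := x)).const_smul
    (-(1 / s))).add (((hasDerivAt_inv (hH0pos x).ne').comp_hasFDerivAt x (hH0 x)).smul (hH1 x)))
  have hval : iteratedFDeriv ℝ 2 (fun y => Real.log (p y)) x ![ξ, ξ] =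
      -(1 / s) * ‖ξ‖ ^ 2 + ((H0 x)⁻¹ * H2 x ξ ξ - ((H0 x) ^ 2)⁻¹ * (H1 x ξ) ^ 2) := by
    rw [iteratedFDeriv_two_apply, hf1]
    erw [hf2.fderiv]
    have hx : innerSL ℝ ξ ξ = ‖ξ‖ ^ 2 := real_inner_self_eq_norm_sq ξ
    simp
    erw [hx]
    ring
  set w : EuclideanSpace ℝ (Fin d) → ℝ := fun y => Real.exp (c * inner ℝ y x) * G0 y with hw
  have hwc : Continuous w := by fun_prop
  have hwpos : ∀ y, 0 < w y := fun y => mul_pos (Real.exp_pos _) (hG0pos y)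
  set m : EuclideanSpace ℝ (Fin d) → ℝ := fun y => c * inner ℝ y ξ with hm
  have hmc : Continuous m := by fun_prop
  have hI0 : H0 x = ∫ y, w y ∂π := rfl
  have hI1 : H1 x ξ = ∫ y, w y * m y ∂π := by
    simp only [H1]
    rw [ContinuousLinearMap.integral_apply (aux_integrable π R hb _ (by fun_prop))]
    congr 1; ext y
    simp [G1, hw, hm]; ring
  have hI2 : H2 x ξ ξ = ∫ y, w y * m y ^ 2 ∂π := by
    simp only [H2]
    have he : Continuous fun y : EuclideanSpace ℝ (Fin d) => Real.exp (c * inner ℝ y x) := by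
      fun_prop
    have hc2 : Continuous fun y : EuclideanSpace ℝ (Fin d) =>
      Real.exp (c * inner ℝ y x) • ((c • innerSL ℝ y).smulRight (G1 y)) :=
        he.smul (aux_cont c G1 hG1)
    have hi := aux_integrable (V := EuclideanSpace ℝ (Fin d) →L[ℝ] EuclideanSpace ℝ (Fin d) →L[ℝ] ℝ)
      π R hb _ hc2
    rw [ContinuousLinearMap.integral_apply hi,
      ContinuousLinearMap.integral_apply (hi.apply_continuousLinearMap ξ)]
    congr 1; ext y
    simp [G1, hw, hm]; ring
  have hi0 := aux_integrable π R hb w hwc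
  have hi1 := aux_integrable π R hb (fun y => w y * m y) (by fun_prop)
  have hi2 := aux_integrable π R hb (fun y => w y * m y ^ 2) (by fun_prop)
  have hA := hH0pos x
  rw [hval, hI1, hI2]
  have key1 : (∫ y, w y * m y ∂π) ^ 2 ≤ H0 x * ∫ y, w y * m y ^ 2 ∂π := by
    set M := ∫ y, w y * m y ∂π with hM
    set Q := ∫ y, w y * m y ^ 2 ∂π with hQ
    have h0 : 0 ≤ ∫ y, w y * (H0 x * m y - M) ^ 2 ∂π :=
      integral_nonneg fun y => mul_nonneg (hwpos y).le (sq_nonneg _)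
    have h1 : ∫ y, w y * (H0 x * m y - M) ^ 2 ∂π =
        (H0 x) ^ 2 * Q - 2 * H0 x * M * M + M ^ 2 * H0 x := by
      have : (fun y => w y * (H0 x * m y - M) ^ 2) = fun y =>
        ((H0 x) ^ 2 * (w y * m y ^ 2) - 2 * H0 x * M * (w y * m y)) + M ^ 2 * w y := by
        ext y; ring
      have hsub : Integrable (fun y => (H0 x) ^ 2 * (w y * m y ^ 2) -
        2 * H0 x * M * (w y * m y)) π := (hi2.const_mul _).sub (hi1.const_mul _)
      rw [this, integral_add hsub (hi0.const_mul _),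
        integral_sub (hi2.const_mul _) (hi1.const_mul _), integral_const_mul, integral_const_mul,
        integral_const_mul, ← hI0]
    rw [h1] at h0
    have : 0 ≤ H0 x * (H0 x * Q - M ^ 2) := by linarith
    linarith [nonneg_of_mul_nonneg_right this hA]
  have key2 : ∫ y, w y * m y ^ 2 ∂π ≤ (l * R ^ 2 / s ^ 2 * ‖ξ‖ ^ 2) * H0 x := by
    rw [hI0, ← integral_const_mul]
    refine integral_mono_ae hi2 (hi0.const_mul _) ?_
    filter_upwards [hb] with y hy
    have hy' : ‖y‖ ≤ R := by simpa using hy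
    have h1 : (inner ℝ y ξ) ^ 2 ≤ (R * ‖ξ‖) ^ 2 := by
      rw [← sq_abs (inner ℝ y ξ)]
      have := abs_real_inner_le_norm y ξ
      have h2 : |inner ℝ y ξ| ≤ R * ‖ξ‖ := this.trans (by gcongr)
      gcongr
    have h3 : m y ^ 2 ≤ l * R ^ 2 / s ^ 2 * ‖ξ‖ ^ 2 := by
      have : l * R ^ 2 / s ^ 2 * ‖ξ‖ ^ 2 = c ^ 2 * (R * ‖ξ‖) ^ 2 := by rw [hc2]; ring
      rw [this, hm]
      simp only [mul_pow c]
      gcongr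
    have := mul_le_mul_of_nonneg_left h3 (hwpos y).le
    linarith
  constructor
  · have : ((H0 x) ^ 2)⁻¹ * (∫ y, w y * m y ∂π) ^ 2 ≤ (H0 x)⁻¹ * ∫ y, w y * m y ^ 2 ∂π := by
      calc _ ≤ ((H0 x) ^ 2)⁻¹ * (H0 x * ∫ y, w y * m y ^ 2 ∂π) := by gcongr
        _ = _ := by field_simp
    linarith
  · have h1 : (H0 x)⁻¹ * ∫ y, w y * m y ^ 2 ∂π ≤ l * R ^ 2 / s ^ 2 * ‖ξ‖ ^ 2 := by
      rw [inv_mul_le_iff₀ hA]; linarith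
    have h2 : 0 ≤ ((H0 x) ^ 2)⁻¹ * (∫ y, w y * m y ∂π) ^ 2 := by positivity
    have h3 : -((s - l * R ^ 2) / s ^ 2) * ‖ξ‖ ^ 2 =
      -(1 / s) * ‖ξ‖ ^ 2 + l * R ^ 2 / s ^ 2 * ‖ξ‖ ^ 2 := by field_simp; ring
    rw [h3]; linarith
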